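/- Every τ-closed set F ⊆ X can be written as F = (⋃_n B_{s_n}) ∪ Z for some sequence of patterns s_0, s_1, … with B_{s_n} ⊆ F for every n and some Z ∈ I. -/

import Mathlib

open Set TopologicalSpace

/-- `I` is a σ-ideal of subsets of `X`: it contains `∅`, is closed under taking
subsets and under countable unions. -/
def IsSigmaIdeal {X : Type*} (I : Set (Set X)) : Prop :=
  ∅ ∈ I ∧ (∀ S T : Set X, S ⊆ T → T ∈ I → S ∈ I) ∧
    ∀ f : ℕ → Set X, (∀ n, f n ∈ I) → (⋃ n, f n) ∈ I

/-- The set `B_s` associated to the pattern with (finite) domain `D` and values `s`: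
`B_s = ⋂_{α ∈ D} A_α^{s α}` where `A^1 = A` and `A^0 = X \ A`. -/
def patternSet {X J : Type*} (A : J → Set X) (D : Finset J) (s : J → Bool) : Set X :=
  ⋂ α ∈ D, if s α then A α else (A α)ᶜ

/-- Two patterns are contradictory if they disagree at some common point of their domains. -/
def Contradictory {J : Type*} (p q : Finset J × (J → Bool)) : Prop :=
  ∃ α, α ∈ p.1 ∧ α ∈ q.1 ∧ p.2 α ≠ q.2 α

/-- Independence mod `I`: `B_s ∉ I` for every pattern `s`. -/
def IndependentModI {X J : Type*} (I : Set (Set X)) (A : J → Set X) : Prop :=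
  ∀ (D : Finset J) (s : J → Bool), patternSet A D s ∉ I

/-- Decomposition: every `S ⊆ X` agrees mod `I` with a countable union of `B_s`'s for
pairwise contradictory patterns. -/
def Decomposition {X J : Type*} (I : Set (Set X)) (A : J → Set X) : Prop :=
  ∀ S : Set X, ∃ P : Set (Finset J × (J → Bool)), P.Countable ∧
    P.Pairwise Contradictory ∧ symmDiff S (⋃ p ∈ P, patternSet A p.1 p.2) ∈ I

/-- Separation: disjoint members of `I` are separated by some `A_α`. -/
def SeparatesIdeal {X J : Type*} (I : Set (Set X)) (A : J → Set X) : Prop :=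
  ∀ Z ∈ I, ∀ Z' ∈ I, Disjoint Z Z' → ∃ α, Z ⊆ A α ∧ Z' ⊆ (A α)ᶜ

/-- The topology `τ` generated by the subbasis
`{A_α \ Z : α ∈ J, Z ∈ I} ∪ {(X \ A_α) \ Z : α ∈ J, Z ∈ I}`. -/
def idealTopology {X J : Type*} (I : Set (Set X)) (A : J → Set X) : TopologicalSpace X :=
  TopologicalSpace.generateFrom
    ({U | ∃ α, ∃ Z ∈ I, U = A α \ Z} ∪ {U | ∃ α, ∃ Z ∈ I, U = (A α)ᶜ \ Z})

theorem IsSigmaIdeal.union_mem {X : Type*} {I : Set (Set X)} (hI : IsSigmaIdeal I)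
    {S T : Set X} (hS : S ∈ I) (hT : T ∈ I) : S ∪ T ∈ I := by
  refine hI.2.1 _ _ ?_ (hI.2.2 (fun n => if n = 0 then S else T) fun n => ?_)
  · rintro x (hx | hx)
    · exact mem_iUnion.2 ⟨0, by simpa using hx⟩
    · exact mem_iUnion.2 ⟨1, by simpa using hx⟩
  · split_ifs <;> assumption

open Classical in
/-- The values of the patterns whose sets contain the point `x`. -/
noncomputable def pointPattern {X J : Type*} (A : J → Set X) (x : X) (α : J) : Bool :=
  decide (x ∈ A α)

theorem mem_patternSet_pointPattern {X J : Type*} {A : J → Set X} {D : Finset J} {x y : X} :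
    y ∈ patternSet A D (pointPattern A x) ↔ ∀ α ∈ D, (y ∈ A α ↔ x ∈ A α) := by
  simp only [patternSet, mem_iInter, pointPattern, decide_eq_true_eq]
  refine forall₂_congr fun α _ => ?_
  split_ifs with h <;> simp_all

theorem patternSet_eq_pointPattern {X J : Type*} {A : J → Set X} {D : Finset J} {s : J → Bool}
    {x : X} (hx : x ∈ patternSet A D s) :
    patternSet A D s = patternSet A D (pointPattern A x) := by
  refine iInter₂_congr fun α hα => ?_
  have h := mem_iInter₂.1 hx α hα
  cases hs : s α <;> simp_all [pointPattern]

theorem patternSet_anti {X J : Type*} (A : J → Set X) (s : J → Bool) {D E : Finset J}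
    (h : D ⊆ E) : patternSet A E s ⊆ patternSet A D s :=
  biInter_subset_biInter_left h

/-- Every `τ`-open set contains, around each of its points, the set of a pattern
up to a member of the ideal. -/
theorem exists_patternSet_diff_subset {X J : Type*} {I : Set (Set X)} {A : J → Set X}
    (hI : IsSigmaIdeal I) {U : Set X} (hU : @IsOpen X (idealTopology I A) U) {x : X} (hx : x ∈ U) :
    ∃ D : Finset J, ∃ Z ∈ I, patternSet A D (pointPattern A x) \ Z ⊆ U := by
  classical
  induction hU with
  | basic U hU =>
    rcases hU with ⟨α, Z, hZ, rfl⟩ | ⟨α, Z, hZ, rfl⟩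
    all_goals
      refine ⟨{α}, Z, hZ, sdiff_subset_sdiff_left fun y hy => ?_⟩
      have h := mem_patternSet_pointPattern.1 hy α (Finset.mem_singleton_self α)
    · exact h.2 hx.1
    · exact fun hyA => hx.1 (h.1 hyA)
  | univ => exact ⟨∅, ∅, hI.1, subset_univ _⟩
  | inter U V _ _ ihU ihV =>
    obtain ⟨D, Z, hZ, hD⟩ := ihU hx.1
    obtain ⟨E, W, hW, hE⟩ := ihV hx.2
    refine ⟨D ∪ E, Z ∪ W, hI.union_mem hZ hW, subset_inter ?_ ?_⟩
    · exact (sdiff_subset_sdiff (patternSet_anti A _ Finset.subset_union_left)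
        subset_union_left).trans hD
    · exact (sdiff_subset_sdiff (patternSet_anti A _ Finset.subset_union_right)
        subset_union_right).trans hE
  | sUnion S _ ih =>
    obtain ⟨U, hU, hxU⟩ := hx
    obtain ⟨D, Z, hZ, hD⟩ := ih U hU hxU
    exact ⟨D, Z, hZ, hD.trans (subset_sUnion_of_mem hU)⟩

/-- A pattern set contained in a `τ`-closed set modulo the ideal is contained in it. -/
theorem patternSet_subset_of_isClosed {X J : Type*} {I : Set (Set X)} {A : J → Set X}
    (hI : IsSigmaIdeal I) (hind : IndependentModI I A) {F : Set X}
    (hF : @IsClosed X (idealTopology I A) F) {D : Finset J} {s : J → Bool}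
    (h : patternSet A D s \ F ∈ I) : patternSet A D s ⊆ F := by
  classical
  intro x hx
  by_contra hxF
  obtain ⟨E, Z, hZ, hE⟩ := exists_patternSet_diff_subset hI hF.isOpen_compl hxF
  rw [patternSet_eq_pointPattern hx] at h
  refine hind (D ∪ E) (pointPattern A x) (hI.2.1 _ _ (fun y hy => ?_) (hI.union_mem h hZ))
  by_cases hyZ : y ∈ Z
  · exact Or.inr hyZ
  · exact Or.inl ⟨patternSet_anti A _ Finset.subset_union_left hy,
      hE ⟨patternSet_anti A _ Finset.subset_union_right hy, hyZ⟩⟩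

theorem stmt_8 {X J : Type*} (I : Set (Set X)) (A : J → Set X)
    (hI : IsSigmaIdeal I) (hX : (Set.univ : Set X) ∉ I) (hsing : ∀ x : X, ({x} : Set X) ∈ I)
    (hind : IndependentModI I A) (hdec : Decomposition I A) (hsep : SeparatesIdeal I A)
    : ∀ F : Set X, @IsClosed X (idealTopology I A) F →
      ∃ P : Set (Finset J × (J → Bool)), P.Countable ∧
        (∀ p ∈ P, patternSet A p.1 p.2 ⊆ F) ∧
        ∃ Z ∈ I, F = (⋃ p ∈ P, patternSet A p.1 p.2) ∪ Z := by
  intro F hF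
  obtain ⟨P, hP, -, hFP⟩ := hdec F
  have hsub : ∀ p ∈ P, patternSet A p.1 p.2 ⊆ F := fun p hp =>
    patternSet_subset_of_isClosed hI hind hF <| hI.2.1 _ _
      (fun _ hy => Or.inr ⟨mem_biUnion hp hy.1, hy.2⟩) hFP
  exact ⟨P, hP, hsub, F \ ⋃ p ∈ P, patternSet A p.1 p.2,
    hI.2.1 _ _ subset_union_left hFP, (union_sdiff_cancel (iUnion₂_subset hsub)).symm⟩
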